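/- Let X be a Banach space, G a group, and H ≤ G a subgroup. If there exists an X-valued invariant λ-mean on G, then there exists an X-valued invariant λ-mean on H. -/

import Mathlib

open scoped ENNReal

noncomputable section

abbrev Linf (S : Type*) (X : Type*) [NormedAddCommGroup X] : Type _ :=
  lp (fun _ : S => X) ⊤

def linfConst (S : Type*) {X : Type*} [NormedAddCommGroup X] (x : X) : Linf S X :=
  ⟨fun _ => x, memℓp_infty ⟨‖x‖, by rintro - ⟨t, rfl⟩; exact le_rfl⟩⟩

def lTrans {S X : Type*} [Add S] [NormedAddCommGroup X] (s : S) (f : Linf S X) : Linf S X :=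
  ⟨fun t => f (s + t), memℓp_infty ⟨‖f‖, by
    rintro - ⟨t, rfl⟩; exact lp.norm_apply_le_norm (by simp) f (s + t)⟩⟩

def rTrans {S X : Type*} [Add S] [NormedAddCommGroup X] (s : S) (f : Linf S X) : Linf S X :=
  ⟨fun t => f (t + s), memℓp_infty ⟨‖f‖, by
    rintro - ⟨t, rfl⟩; exact lp.norm_apply_le_norm (by simp) f (t + s)⟩⟩

def IsInvMean {S X : Type*} [Add S] [NormedAddCommGroup X] [NormedSpace ℝ X]
    (lam : ℝ) (M : Linf S X →L[ℝ] X) : Prop :=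
  ‖M‖ ≤ lam ∧ (∀ x : X, M (linfConst S x) = x) ∧
    ∀ (s : S) (f : Linf S X), M (lTrans s f) = M f ∧ M (rTrans s f) = M f

theorem theta_uncountable (G : Type*) [AddGroup G] [Uncountable G] :
    ∃ θ : G → Finset G, ∀ s, ∃ t : ℕ → G, ∀ i j, i < j → ∀ g,
      s ∈ θ (g + t i) ∨ s ∈ θ (g + t j) := by
  classical
  let : LinearOrder G := linearOrderOfSTO WellOrderingRel
  have : WellFoundedLT G := ⟨(inferInstance : IsWellFounded G WellOrderingRel).wf⟩
  let L : G → AddSubgroup G := fun x => AddSubgroup.closure (Set.Iio x)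
  let K : G → AddSubgroup G := fun x => AddSubgroup.closure (Set.Iic x)
  have hLK : ∀ x, L x ≤ K x := fun x => AddSubgroup.closure_mono Set.Iio_subset_Iic_self
  have hKL : ∀ x y, x < y → K x ≤ L y := fun x y h =>
    AddSubgroup.closure_mono (fun z hz => lt_of_le_of_lt hz h)
  let I : Set G := {x | x ∉ L x}
  have hgen : AddSubgroup.closure I = ⊤ := by
    rw [eq_top_iff]
    intro x _
    induction x using WellFoundedLT.induction with
    | ind x ih =>
      by_cases hx : x ∈ I
      · exact AddSubgroup.subset_closure hx
      · have hx' : x ∈ L x := by simpa [I] using hx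
        have : L x ≤ AddSubgroup.closure I := (AddSubgroup.closure_le _).2
          (fun y hy => ih y hy trivial)
        exact this hx'
  have hsurj : Function.Surjective (FreeAddGroup.lift ((↑) : I → G)) := by
    rw [← AddMonoidHom.range_eq_top, FreeAddGroup.range_lift_eq_closure]
    simpa using hgen
  have hIinf : Infinite I := by
    by_contra hfin
    rw [not_infinite_iff_finite] at hfin
    have : Countable G := hsurj.countable
    exact not_countable (α := G) this
  have hcard : Cardinal.mk (G × ℕ) ≤ Cardinal.mk I := by
    have h1 : Cardinal.mk G ≤ Cardinal.mk I := by
      refine (Cardinal.mk_le_of_surjective hsurj).trans ?_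
      simp
    simp only [Cardinal.mk_prod, Cardinal.lift_uzero, Cardinal.mk_nat, Cardinal.lift_aleph0]
    rw [Cardinal.mul_aleph0_eq (Cardinal.aleph0_le_mk G)]
    exact h1
  obtain ⟨e⟩ := Cardinal.le_def _ _ |>.1 hcard
  let mn : AddSubgroup G → G → G := fun A g =>
    WellFounded.min (wellFounded_lt (α := G)) {z | -g + z ∈ A} ⟨g, by simp [A.zero_mem]⟩
  have mn_mem : ∀ A g, -g + mn A g ∈ A := fun A g =>
    WellFounded.min_mem (wellFounded_lt (α := G)) {z | -g + z ∈ A} ⟨g, by simp [A.zero_mem]⟩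
  have mn_le : ∀ (A : AddSubgroup G) g z, -g + z ∈ A → mn A g ≤ z := fun A g z hz =>
    not_lt.1 (WellFounded.not_lt_min (wellFounded_lt (α := G)) {z | -g + z ∈ A} hz)
  have mn_anti : ∀ (A B : AddSubgroup G) g, A ≤ B → mn B g ≤ mn A g := fun A B g h =>
    mn_le B g _ (h (mn_mem A g))
  let supp : G → Set G := fun g => {x | mn (K x) g < mn (L x) g}
  have hfin : ∀ g, (supp g).Finite := by
    intro g
    have hanti : ∀ x y : supp g, x < y → mn (K y) g < mn (K x) g := fun x y hxy =>
      lt_of_lt_of_le y.2 (mn_anti _ _ g (hKL x y hxy))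
    have : WellFoundedGT (supp g) := by
      refine ⟨Subrelation.wf (r := InvImage (· < ·) (fun x : supp g => mn (K x) g)) ?_
        (InvImage.wf _ wellFounded_lt)⟩
      intro x y h
      exact hanti y x h
    exact Set.finite_coe_iff.1 (Finite.of_wellFoundedLT_wellFoundedGT (supp g))
  have key : ∀ x g s, x ∉ supp g → x ∉ supp (g + s) → s ∈ K x → s ∈ L x := by
    intro x g s h1 h2 hs
    have a1 : mn (K x) g = mn (L x) g := le_antisymm (mn_anti _ _ _ (hLK x)) (not_lt.1 h1)
    have a2 : mn (K x) (g + s) = mn (L x) (g + s) :=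
      le_antisymm (mn_anti _ _ _ (hLK x)) (not_lt.1 h2)
    have a3 : mn (K x) g = mn (K x) (g + s) := by
      apply le_antisymm
      · apply mn_le
        have := (K x).add_mem hs (mn_mem (K x) (g + s))
        simpa [add_assoc, neg_add_rev] using this
      · apply mn_le
        have := (K x).add_mem ((K x).neg_mem hs) (mn_mem (K x) g)
        simpa [add_assoc, neg_add_rev] using this
    have b1 := mn_mem (L x) g
    have b2 := mn_mem (L x) (g + s)
    rw [← a2, ← a3, a1] at b2
    have := (L x).add_mem b1 ((L x).neg_mem b2)
    simpa [add_assoc, neg_add_rev] using this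
  refine ⟨fun g => (((hfin g).preimage (f := fun p : G × ℕ => ((e p : I) : G))
    (fun a _ b _ h => e.injective (Subtype.ext h))).toFinset).image Prod.fst, ?_⟩
  intro s
  refine ⟨fun n => e (s, n), ?_⟩
  have main : ∀ i j, (e (s, i) : G) < e (s, j) → ∀ g,
      (∃ n, (e (s,n) : G) ∈ supp (g + e (s, i))) ∨ (∃ n, (e (s,n) : G) ∈ supp (g + e (s, j))) := by
    intro i j hij g
    by_contra! hcon
    have hj := key (e (s, j)) (g + e (s, i)) (- (e (s,i) : G) + e (s, j)) (hcon.1 j)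
      (by simpa [add_assoc] using hcon.2 j)
      ((K _).add_mem ((K _).neg_mem (AddSubgroup.subset_closure hij.le))
        (AddSubgroup.subset_closure (Set.mem_Iic.2 le_rfl)))
    have hi : (e (s,i) : G) ∈ L (e (s, j)) := AddSubgroup.subset_closure hij
    have := (L _).add_mem hi hj
    rw [add_neg_cancel_left] at this
    exact (e (s, j)).2 this
  have conv : ∀ g, (∃ n, (e (s,n) : G) ∈ supp g) → s ∈ (((hfin g).preimage (f := fun p : G × ℕ => ((e p : I) : G))
    (fun a _ b _ h => e.injective (Subtype.ext h))).toFinset).image Prod.fst := by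
    rintro g ⟨n, hn⟩
    rw [Finset.mem_image]
    exact ⟨(s, n), by simpa using hn, rfl⟩
  intro i j hij g
  have hne : (e (s, i) : G) ≠ e (s, j) := by
    intro h
    have := e.injective (Subtype.ext h)
    simp at this
    omega
  rcases lt_or_gt_of_ne hne with h | h
  · exact (main i j h g).imp (conv _) (conv _)
  · exact ((main j i h g).imp (conv _) (conv _)).symm

theorem theta_countable (G : Type*) [AddGroup G] [Infinite G] [Countable G] :
    ∃ θ : G → Finset G, ∀ s, ∃ t : ℕ → G, ∀ i j, i < j → ∀ g,
      s ∈ θ (g + t i) ∨ s ∈ θ (g + t j) := by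
  classical
  obtain ⟨e, he⟩ := exists_injective_nat G
  have hf : ∀ n, {s | e s ≤ n}.Finite := fun n => (Set.finite_Iic n).preimage he.injOn
  refine ⟨fun g => (hf (e g)).toFinset, fun s => ?_⟩
  let D : Finset G := (hf (e s)).toFinset
  obtain ⟨t, -, ht⟩ := exists_seq_of_forall_finset_exists (fun _ : G => True)
    (fun x y => ∀ g, g + x ∈ D → g + y ∉ D) (by
      intro S _
      obtain ⟨y, hy⟩ := Infinite.exists_notMem_finset
        (((S ×ˢ (D ×ˢ D))).image (fun p => p.1 + (- p.2.1 + p.2.2)))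
      refine ⟨y, trivial, fun x hx g h1 h2 => hy ?_⟩
      rw [Finset.mem_image]
      refine ⟨(x, (g + x, g + y)), by simp [hx, h1, h2], ?_⟩
      simp [add_assoc])
  refine ⟨t, fun i j hij g => ?_⟩
  by_contra! h
  refine ht i j hij g ?_ ?_
  · have := h.1
    simp [D] at this ⊢
    omega
  · have := h.2
    simp [D] at this ⊢
    omega

def l1n {α : Type*} (ν : α →₀ ℝ) : ℝ := ν.sum fun _ x => |x|

theorem l1n_eq {α : Type*} (ν : α →₀ ℝ) (A : Finset α) (h : ν.support ⊆ A) :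
    l1n ν = ∑ a ∈ A, |ν a| :=
  Finsupp.sum_of_support_subset _ h _ (by simp)

theorem l1n_nonneg {α : Type*} (ν : α →₀ ℝ) : 0 ≤ l1n ν :=
  Finset.sum_nonneg fun _ _ => abs_nonneg _

theorem l1n_smul {α : Type*} (c : ℝ) (ν : α →₀ ℝ) : l1n (c • ν) = |c| * l1n ν := by
  rw [l1n_eq (c • ν) ν.support Finsupp.support_smul, l1n_eq ν _ subset_rfl, Finset.mul_sum]
  simp [abs_mul]

theorem l1n_add {α : Type*} (μ ν : α →₀ ℝ) : l1n (μ + ν) ≤ l1n μ + l1n ν := by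
  classical
  rw [l1n_eq (μ + ν) _ Finsupp.support_add, l1n_eq μ _ Finset.subset_union_left,
    l1n_eq ν _ Finset.subset_union_right, ← Finset.sum_add_distrib]
  exact Finset.sum_le_sum fun a _ => abs_add_le _ _

theorem l1n_single {α : Type*} (a : α) (c : ℝ) : l1n (Finsupp.single a c) = |c| := by
  simp [l1n]

theorem norm_lc_le {α X : Type*} [NormedAddCommGroup X] [NormedSpace ℝ X] (F : α → X) (C : ℝ)
    (hF : ∀ a, ‖F a‖ ≤ C) (ν : α →₀ ℝ) :
    ‖Finsupp.linearCombination ℝ F ν‖ ≤ C * l1n ν := by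
  rw [Finsupp.linearCombination_apply, l1n, Finsupp.sum, Finsupp.sum, Finset.mul_sum]
  refine (norm_sum_le _ _).trans (Finset.sum_le_sum fun a _ => ?_)
  rw [norm_smul, Real.norm_eq_abs, mul_comm]
  exact mul_le_mul_of_nonneg_right (hF a) (abs_nonneg _)

def absF {α : Type*} (ν : α →₀ ℝ) : α →₀ ℝ := ν.mapRange (fun x => |x|) abs_zero

theorem l1n_absF_sub {α : Type*} (μ ν : α →₀ ℝ) : l1n (absF μ - absF ν) ≤ l1n (μ - ν) := by
  classical
  rw [l1n_eq (absF μ - absF ν) ((absF μ - absF ν).support ∪ (μ - ν).support)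
    Finset.subset_union_left, l1n_eq (μ - ν) _ Finset.subset_union_right]
  exact Finset.sum_le_sum fun a _ => abs_abs_sub_abs_le _ _

theorem absF_mapDomain {α β : Type*} (f : α → β) (hf : Function.Injective f) (μ : α →₀ ℝ) :
    Finsupp.mapDomain f (absF μ) = absF (Finsupp.mapDomain f μ) := by
  ext b
  by_cases hb : b ∈ Set.range f
  · obtain ⟨a, rfl⟩ := hb
    simp [absF, Finsupp.mapDomain_apply hf]
  · simp [absF, Finsupp.mapDomain_of_notMem_range _ _ hb]

theorem lc_absF_one {α : Type*} (μ : α →₀ ℝ) :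
    Finsupp.linearCombination ℝ (fun _ : α => (1 : ℝ)) (absF μ) = l1n μ := by
  rw [Finsupp.linearCombination_apply, absF, Finsupp.sum_mapRange_index (by simp)]
  simp [l1n]

theorem l1n_absF {α : Type*} (μ : α →₀ ℝ) : l1n (absF μ) = l1n μ := by
  rw [l1n, absF, Finsupp.sum_mapRange_index (by simp)]
  simp [l1n]

/-- The Reiter condition. -/
theorem exists_reiter {H : Type*} [AddGroup H] (m : Linf H ℝ →ₗ[ℝ] ℝ)
    (h1 : m (linfConst H 1) = 1) (hm : ∀ s f, m (lTrans s f) = m f)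
    (F : Finset H) (ε : ℝ) (hε : 0 < ε) :
    ∃ p : H →₀ ℝ, l1n p = 1 ∧ Finsupp.linearCombination ℝ (fun _ : H => (1 : ℝ)) p = 1 ∧
      ∀ s ∈ F, l1n (p.mapDomain (fun h => s + h) - p) ≤ ε := by
  classical
  let mass : (H →₀ ℝ) →ₗ[ℝ] ℝ := Finsupp.linearCombination ℝ (fun _ : H => (1 : ℝ))
  let T : (H →₀ ℝ) →ₗ[ℝ] (F → (H →₀ ℝ)) :=
    LinearMap.pi fun s => Finsupp.lmapDomain ℝ ℝ (fun h => (s : H) + h) - LinearMap.id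
  have hT : ∀ μ s, T μ s = μ.mapDomain (fun h => (s : H) + h) - μ := fun μ s => rfl
  let N : (F → (H →₀ ℝ)) → ℝ := fun ν => ε⁻¹ * ∑ s, l1n (ν s)
  have claim : ∃ μ, N (T μ) < mass μ := by
    by_contra! hcon
    have hN0 : N 0 = 0 := by simp [N, l1n]
    have hker : mass ∈ (LinearMap.ker T).dualAnnihilator := by
      rw [Submodule.mem_dualAnnihilator]
      intro μ hμ
      rw [LinearMap.mem_ker] at hμ
      have a1 := hcon μ
      have a2 := hcon (-μ)
      rw [map_neg, map_neg, hμ, neg_zero, hN0] at a2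
      rw [hμ, hN0] at a1
      linarith
    rw [← LinearMap.range_dualMap_eq_dualAnnihilator_ker] at hker
    obtain ⟨g0, hg0⟩ := hker
    obtain ⟨g, hg1, hg2⟩ := exists_extension_of_le_sublinear
      (⟨LinearMap.range T, g0.domRestrict _⟩ : (F → (H →₀ ℝ)) →ₗ.[ℝ] ℝ) N
      (by
        intro c hc x
        simp only [N, Pi.smul_apply, l1n_smul, abs_of_pos hc, ← Finset.mul_sum]
        ring)
      (by
        intro x y
        simp only [N, ← mul_add, ← Finset.sum_add_distrib]
        refine mul_le_mul_of_nonneg_left (Finset.sum_le_sum fun s _ => l1n_add _ _)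
          (inv_nonneg.2 hε.le))
      (by
        rintro ⟨x, ⟨μ, rfl⟩⟩
        change g0 (T μ) ≤ N (T μ)
        rw [← LinearMap.dualMap_apply, hg0]
        exact hcon μ)
    have hgT : ∀ μ, g (T μ) = mass μ := by
      intro μ
      have := hg1 ⟨T μ, ⟨μ, rfl⟩⟩
      rw [← hg0]
      exact this
    let φ : F → H → ℝ := fun s k => g (Pi.single s (Finsupp.single k 1))
    have hφN : ∀ s k (c : ℝ), N (Pi.single s (Finsupp.single k c)) = ε⁻¹ * |c| := by
      intro s k c
      simp only [N]
      rw [Finset.sum_eq_single s]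
      · simp [l1n_single]
      · intro b _ hb
        simp [hb, l1n]
      · simp
    have hφ : ∀ s k, ‖φ s k‖ ≤ ε⁻¹ := by
      intro s k
      rw [Real.norm_eq_abs, abs_le]
      have a1 := hg2 (Pi.single s (Finsupp.single k 1))
      have a2 := hg2 (Pi.single s (Finsupp.single k (-1)))
      rw [hφN] at a1 a2
      rw [Finsupp.single_neg, Pi.single_neg, map_neg] at a2
      simp only [abs_neg, abs_one, mul_one] at a1 a2
      exact ⟨by change _ ≤ g _; linarith, a1⟩
    let Φ : F → Linf H ℝ := fun s => ⟨φ s, memℓp_infty ⟨ε⁻¹, by rintro - ⟨k, rfl⟩; exact hφ s k⟩⟩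
    have hsum : linfConst H (1 : ℝ) = ∑ s : F, (lTrans (s : H) (Φ s) - Φ s) := by
      ext h
      rw [lp.coeFn_sum, Finset.sum_apply]
      change (1 : ℝ) = ∑ s : F, (φ s (s + h) - φ s h)
      have e1 : mass (Finsupp.single h 1) = 1 := by simp [mass]
      rw [← e1, ← hgT, ← Finset.univ_sum_single (T (Finsupp.single h 1)), map_sum]
      refine Finset.sum_congr rfl fun s _ => ?_
      rw [hT, Finsupp.mapDomain_single, Pi.single_sub, map_sub]
    have := congrArg m hsum
    rw [h1, map_sum] at this
    simp [hm] at this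
  obtain ⟨μ, hμ⟩ := claim
  have hmass : mass μ ≤ l1n μ := by
    have := norm_lc_le (fun _ : H => (1 : ℝ)) 1 (by simp) μ
    rw [one_mul] at this
    exact (le_abs_self _).trans this
  have hsumnn : 0 ≤ ∑ s, l1n (T μ s) := Finset.sum_nonneg fun _ _ => l1n_nonneg _
  have hNnn : 0 ≤ N (T μ) := mul_nonneg (inv_nonneg.2 hε.le) hsumnn
  have hpos : 0 < l1n μ := by linarith
  refine ⟨(l1n μ)⁻¹ • absF μ, ?_, ?_, ?_⟩
  · rw [l1n_smul, l1n_absF, abs_of_pos (inv_pos.2 hpos), inv_mul_cancel₀ hpos.ne']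
  · rw [map_smul, lc_absF_one, smul_eq_mul, inv_mul_cancel₀ hpos.ne']
  · intro s hs
    rw [Finsupp.mapDomain_smul, ← smul_sub, l1n_smul, abs_of_pos (inv_pos.2 hpos),
      absF_mapDomain _ (add_right_injective s), inv_mul_le_iff₀ hpos]
    refine (l1n_absF_sub _ _).trans ?_
    have a1 : l1n (T μ ⟨s, hs⟩) ≤ ∑ s, l1n (T μ s) :=
      Finset.single_le_sum (f := fun s => l1n (T μ s)) (fun _ _ => l1n_nonneg _) (Finset.mem_univ _)
    have a2 : ε⁻¹ * ∑ s, l1n (T μ s) < l1n μ := lt_of_lt_of_le hμ hmass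
    rw [inv_mul_lt_iff₀ hε] at a2
    rw [hT] at a1
    change l1n (μ.mapDomain (fun h => s + h) - μ) ≤ _ at a1
    linarith

def mkL {S X : Type*} [NormedAddCommGroup X] (u : S → X) (C : ℝ) (h : ∀ g, ‖u g‖ ≤ C) :
    Linf S X :=
  ⟨u, memℓp_infty ⟨C, by rintro - ⟨t, rfl⟩; exact h t⟩⟩

theorem mkL_apply {S X : Type*} [NormedAddCommGroup X] (u : S → X) (C : ℝ)
    (h : ∀ g, ‖u g‖ ≤ C) (g : S) : mkL u C h g = u g := rfl

theorem linf_norm_apply_le {S X : Type*} [NormedAddCommGroup X] (u : Linf S X) (g : S) :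
    ‖u g‖ ≤ ‖u‖ := lp.norm_apply_le_norm (by simp) u g

theorem zero_of_forall_mul_le {X : Type*} [NormedAddCommGroup X] (x : X) (K : ℝ) (hK : 0 ≤ K)
    (h : ∀ δ : ℝ, 0 < δ → ‖x‖ ≤ K * δ) : x = 0 := by
  rw [← norm_le_zero_iff]
  refine le_of_forall_pos_le_add fun ε hε => ?_
  refine (h (ε / (K + 1)) (by positivity)).trans ?_
  rw [zero_add, mul_div_assoc', div_le_iff₀ (by positivity)]
  nlinarith

theorem mean_null {G X : Type*} [AddGroup G] [NormedAddCommGroup X] [NormedSpace ℝ X]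
    (lam : ℝ) (M : Linf G X →L[ℝ] X) (hM : IsInvMean lam M) (t : ℕ → G) (u : Linf G X)
    (hu : ∀ i j, i < j → ∀ g, u (g + t i) = 0 ∨ u (g + t j) = 0) : M u = 0 := by
  classical
  have key : ∀ n : ℕ, (n : ℝ) * ‖M u‖ ≤ ‖M‖ * ‖u‖ := by
    intro n
    have e : (n : ℝ) • M u = M (∑ i ∈ Finset.range n, rTrans (t i) u) := by
      rw [map_sum, Finset.sum_congr rfl fun i _ => (hM.2.2 (t i) u).2]
      rw [Finset.sum_const, Finset.card_range, Nat.cast_smul_eq_nsmul]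
    have b : ‖∑ i ∈ Finset.range n, rTrans (t i) u‖ ≤ ‖u‖ := by
      refine lp.norm_le_of_forall_le (norm_nonneg _) fun g => ?_
      rw [lp.coeFn_sum, Finset.sum_apply]
      change ‖∑ i ∈ Finset.range n, u (g + t i)‖ ≤ _
      by_cases h0 : ∃ i ∈ Finset.range n, u (g + t i) ≠ 0
      · obtain ⟨i, hi, hne⟩ := h0
        rw [Finset.sum_eq_single_of_mem i hi]
        · exact linf_norm_apply_le u _
        · intro j _ hj
          rcases lt_or_gt_of_ne hj with h | h
          · exact (hu j i h g).resolve_right hne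
          · exact (hu i j h g).resolve_left hne
      · push Not at h0
        rw [Finset.sum_eq_zero h0]
        simp
    calc (n : ℝ) * ‖M u‖ = ‖(n : ℝ) • M u‖ := by rw [norm_smul]; simp
      _ ≤ ‖M‖ * ‖∑ i ∈ Finset.range n, rTrans (t i) u‖ := by rw [e]; exact M.le_opNorm _
      _ ≤ _ := mul_le_mul_of_nonneg_left b (norm_nonneg _)
  refine zero_of_forall_mul_le _ (‖M‖ * ‖u‖) (by positivity) fun δ hδ => ?_
  obtain ⟨n, hn⟩ := exists_nat_gt (δ⁻¹)
  have hn0 : 0 < (n : ℝ) := (inv_pos.2 hδ).trans hn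
  have k := key n
  have : 1 ≤ δ * n := by
    rw [inv_lt_iff_one_lt_mul₀ hδ] at hn
    linarith
  nlinarith [norm_nonneg (M u)]

open Classical in
def cutL {S X : Type*} [NormedAddCommGroup X] (P : S → Prop) (u : Linf S X) : Linf S X :=
  mkL (fun g => if P g then u g else 0) ‖u‖ (by
    intro g
    split_ifs
    · exact linf_norm_apply_le u g
    · simp)

open Classical in
theorem cutL_apply {S X : Type*} [NormedAddCommGroup X] (P : S → Prop) (u : Linf S X) (g : S) :
    cutL P u g = if P g then u g else 0 := rfl

theorem cutL_add {S X : Type*} [NormedAddCommGroup X] (P : S → Prop) (u : Linf S X) :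
    cutL P u + cutL (fun g => ¬ P g) u = u := by
  ext g
  rw [lp.coeFn_add, Pi.add_apply, cutL_apply, cutL_apply]
  by_cases h : P g <;> simp [h]

theorem mean_null_finset {G X : Type*} [AddGroup G] [NormedAddCommGroup X] [NormedSpace ℝ X]
    (lam : ℝ) (M : Linf G X →L[ℝ] X) (hM : IsInvMean lam M) (θ : G → Finset G)
    (hθ : ∀ s, ∃ t : ℕ → G, ∀ i j, i < j → ∀ g, s ∈ θ (g + t i) ∨ s ∈ θ (g + t j))
    (S : Finset G) : ∀ u : Linf G X, (∀ g, S ⊆ θ g → u g = 0) → M u = 0 := by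
  classical
  induction S using Finset.induction_on with
  | empty =>
    intro u hu
    have : u = 0 := by
      ext g
      simpa using hu g (by simp)
    rw [this, map_zero]
  | insert a S _ ih =>
    intro u hu
    rw [← cutL_add (fun g => a ∈ θ g) u, map_add, ih, zero_add]
    · obtain ⟨t, ht⟩ := hθ a
      refine mean_null lam M hM t _ fun i j hij g => ?_
      rw [cutL_apply, cutL_apply]
      exact (ht i j hij g).imp (fun h => by simp [h]) (fun h => by simp [h])
    · intro g hg
      rw [cutL_apply]
      split_ifs with h
      · exact hu g (Finset.insert_subset h hg)
      · rfl

theorem mean_small {G X : Type*} [AddGroup G] [NormedAddCommGroup X] [NormedSpace ℝ X]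
    (lam : ℝ) (M : Linf G X →L[ℝ] X) (hM : IsInvMean lam M) (θ : G → Finset G)
    (hθ : ∀ s, ∃ t : ℕ → G, ∀ i j, i < j → ∀ g, s ∈ θ (g + t i) ∨ s ∈ θ (g + t j))
    (S : Finset G) (u : Linf G X) (δ : ℝ) (hδ : 0 ≤ δ) (hu : ∀ g, S ⊆ θ g → ‖u g‖ ≤ δ) :
    ‖M u‖ ≤ lam * δ := by
  rw [← cutL_add (fun g => S ⊆ θ g) u, map_add,
    mean_null_finset lam M hM θ hθ S (cutL (fun g => ¬ S ⊆ θ g) u)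
      (fun g hg => by rw [cutL_apply]; simp [hg]), add_zero]
  refine (M.le_opNorm _).trans ?_
  refine mul_le_mul hM.1 ?_ (norm_nonneg _) ((norm_nonneg _).trans hM.1)
  refine lp.norm_le_of_forall_le hδ fun g => ?_
  rw [cutL_apply]
  split_ifs with h
  · exact hu g h
  · simpa using hδ

/-- The double average of `f` along `p`. -/
def dAvg {H X : Type*} [AddGroup H] [NormedAddCommGroup X] [NormedSpace ℝ X]
    (p : H →₀ ℝ) (f : H → X) : X :=
  Finsupp.linearCombination ℝ (fun a => Finsupp.linearCombination ℝ (fun b => f (a - b)) p) p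

theorem lc_add_fun {α X : Type*} [NormedAddCommGroup X] [NormedSpace ℝ X] (F F' : α → X)
    (p : α →₀ ℝ) : Finsupp.linearCombination ℝ (fun a => F a + F' a) p =
      Finsupp.linearCombination ℝ F p + Finsupp.linearCombination ℝ F' p := by
  simp [Finsupp.linearCombination_apply, Finsupp.sum, Finset.sum_add_distrib]

theorem lc_sub_fun {α X : Type*} [NormedAddCommGroup X] [NormedSpace ℝ X] (F F' : α → X)
    (p : α →₀ ℝ) : Finsupp.linearCombination ℝ (fun a => F a - F' a) p =
      Finsupp.linearCombination ℝ F p - Finsupp.linearCombination ℝ F' p := by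
  simp [Finsupp.linearCombination_apply, Finsupp.sum, smul_sub, Finset.sum_sub_distrib]

theorem lc_smul_fun {α X : Type*} [NormedAddCommGroup X] [NormedSpace ℝ X] (c : ℝ) (F : α → X)
    (p : α →₀ ℝ) : Finsupp.linearCombination ℝ (fun a => c • F a) p =
      c • Finsupp.linearCombination ℝ F p := by
  simp [Finsupp.linearCombination_apply, Finsupp.sum, Finset.smul_sum, smul_comm c]

theorem lc_const_fun {α X : Type*} [NormedAddCommGroup X] [NormedSpace ℝ X] (x : X)
    (p : α →₀ ℝ) (hp : Finsupp.linearCombination ℝ (fun _ : α => (1 : ℝ)) p = 1) :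
    Finsupp.linearCombination ℝ (fun _ => x) p = x := by
  have : Finsupp.linearCombination ℝ (fun _ => x) p =
      (Finsupp.linearCombination ℝ (fun _ : α => (1 : ℝ)) p) • x := by
    simp [Finsupp.linearCombination_apply, Finsupp.sum, Finset.sum_smul]
  rw [this, hp, one_smul]

section dAvg
variable {H X : Type*} [AddGroup H] [NormedAddCommGroup X] [NormedSpace ℝ X]

theorem dAvg_norm_le (p : H →₀ ℝ) (hp : l1n p = 1) (f : Linf H X) : ‖dAvg p f‖ ≤ ‖f‖ := by
  have h1 : ∀ a, ‖Finsupp.linearCombination ℝ (fun b => f (a - b)) p‖ ≤ ‖f‖ := fun a => by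
    simpa [hp] using norm_lc_le (fun b => f (a - b)) ‖f‖ (fun b => linf_norm_apply_le f _) p
  have h2 := norm_lc_le _ ‖f‖ h1 p
  rw [hp, mul_one] at h2
  exact h2

theorem dAvg_left (p : H →₀ ℝ) (hp : l1n p = 1) (f : Linf H X) (s : H) :
    ‖dAvg p (lTrans s f) - dAvg p f‖ ≤ ‖f‖ * l1n (p.mapDomain (fun h => s + h) - p) := by
  let K : H → X := fun a => Finsupp.linearCombination ℝ (fun b => f (a - b)) p
  have h1 : ∀ a, ‖K a‖ ≤ ‖f‖ := fun a => by
    simpa [hp] using norm_lc_le (fun b => f (a - b)) ‖f‖ (fun b => linf_norm_apply_le f _) p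
  have e : dAvg p (lTrans s f) = Finsupp.linearCombination ℝ K (p.mapDomain (fun h => s + h)) := by
    rw [Finsupp.linearCombination_mapDomain]
    unfold dAvg
    congr 2
    ext a
    change Finsupp.linearCombination ℝ (fun b => f (s + (a - b))) p =
      Finsupp.linearCombination ℝ (fun b => f (s + a - b)) p
    simp only [add_sub_assoc]
  have e2 : dAvg p f = Finsupp.linearCombination ℝ K p := rfl
  rw [e, e2, ← map_sub]
  exact norm_lc_le K _ h1 _

theorem dAvg_right (p : H →₀ ℝ) (hp : l1n p = 1) (f : Linf H X) (s : H) :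
    ‖dAvg p (rTrans s f) - dAvg p f‖ ≤ ‖f‖ * l1n (p.mapDomain (fun h => -s + h) - p) := by
  unfold dAvg
  rw [← lc_sub_fun]
  refine (norm_lc_le _ _ (fun a => ?_) p).trans_eq (by rw [hp, mul_one])
  have e : Finsupp.linearCombination ℝ (fun b => rTrans s f (a - b)) p =
      Finsupp.linearCombination ℝ (fun b => f (a - b)) (p.mapDomain (fun h => -s + h)) := by
    rw [Finsupp.linearCombination_mapDomain]
    congr 2
    ext b
    change f (a - b + s) = f (a - (-s + b))
    simp [sub_eq_add_neg, neg_add_rev, add_assoc]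
  rw [e, ← map_sub]
  exact norm_lc_le (fun b => f (a - b)) _ (fun b => linf_norm_apply_le f (a - b)) _

end dAvg

theorem exists_retract {G : Type*} [AddGroup G] (H : AddSubgroup G) :
    ∃ π : G → H, ∀ (s : H) (g : G), π (s + g) = s + π g := by
  let q : G → Quotient (QuotientAddGroup.rightRel H) := fun g => Quotient.mk _ g
  have hq : ∀ g, g - (q g).out ∈ H := by
    intro g
    have := Quotient.mk_out (s := QuotientAddGroup.rightRel H) g
    have := QuotientAddGroup.rightRel_apply.1 this
    rwa [sub_eq_add_neg]
  refine ⟨fun g => ⟨g - (q g).out, hq g⟩, fun s g => ?_⟩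
  have : q (s + g) = q g := by
    apply Quotient.sound
    apply QuotientAddGroup.rightRel_apply.2
    simp [neg_add_rev]
  apply Subtype.ext
  simp [this, add_sub_assoc]

theorem exists_scalar_mean {G X : Type*} [AddGroup G] [NormedAddCommGroup X] [NormedSpace ℝ X]
    [Nontrivial X] (H : AddSubgroup G) (lam : ℝ) (M : Linf G X →L[ℝ] X) (hM : IsInvMean lam M) :
    ∃ m : Linf H ℝ →ₗ[ℝ] ℝ, m (linfConst H 1) = 1 ∧ ∀ s f, m (lTrans s f) = m f := by
  obtain ⟨π, hπ⟩ := exists_retract H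
  obtain ⟨x, hx⟩ := exists_ne (0 : X)
  obtain ⟨ξ, hξ⟩ := SeparatingDual.exists_eq_one (R := ℝ) hx
  let P : Linf H ℝ → Linf G X := fun f => mkL (fun g => f (π g) • x) (‖f‖ * ‖x‖) (fun g => by
    rw [norm_smul]
    exact mul_le_mul_of_nonneg_right (linf_norm_apply_le f _) (norm_nonneg _))
  refine ⟨{ toFun := fun f => ξ (M (P f)), map_add' := ?_, map_smul' := ?_ }, ?_, ?_⟩
  · intro f f'
    have : P (f + f') = P f + P f' := by
      ext g
      exact add_smul _ _ _
    rw [this, map_add, map_add]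
  · intro c f
    have : P (c • f) = c • P f := by
      ext g
      exact mul_smul _ _ _
    rw [this, map_smul, map_smul]
    rfl
  · have : P (linfConst H 1) = linfConst G x := by
      ext g
      exact one_smul _ _
    change ξ (M (P (linfConst H 1))) = 1
    rw [this, hM.2.1, hξ]
  · intro s f
    have : P (lTrans s f) = lTrans (s : G) (P f) := by
      ext g
      change f (s + π g) • x = f (π (s + g)) • x
      rw [hπ]
    change ξ (M (P (lTrans s f))) = ξ (M (P f))
    rw [this, (hM.2.2 s _).1]

theorem finite_case {H X : Type*} [AddGroup H] [Finite H] [NormedAddCommGroup X] [NormedSpace ℝ X]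
    (lam : ℝ) (hlam : 1 ≤ lam) : ∃ M' : Linf H X →L[ℝ] X, IsInvMean lam M' := by
  classical
  have := Fintype.ofFinite H
  have hc : (0 : ℝ) < Fintype.card H := by exact_mod_cast Fintype.card_pos
  let A : Linf H X →ₗ[ℝ] X :=
    { toFun := fun f => (Fintype.card H : ℝ)⁻¹ • ∑ h, f h
      map_add' := fun f f' => by
        have e : ∑ h, (f + f') h = ∑ h, f h + ∑ h, f' h :=
          Finset.sum_add_distrib (f := fun h => (f h : X)) (g := fun h => (f' h : X))
        rw [e, smul_add]
      map_smul' := fun c f => by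
        simp only [lp.coeFn_smul, Pi.smul_apply, ← Finset.smul_sum, RingHom.id_apply]
        rw [smul_comm] }
  have hA : ∀ f, ‖A f‖ ≤ lam * ‖f‖ := by
    intro f
    change ‖(Fintype.card H : ℝ)⁻¹ • ∑ h, f h‖ ≤ _
    have h1 : ‖∑ h, f h‖ ≤ Fintype.card H * ‖f‖ := by
      refine (norm_sum_le _ _).trans ?_
      refine (Finset.sum_le_sum fun h _ => linf_norm_apply_le f h).trans ?_
      simp
    rw [norm_smul, norm_inv, Real.norm_of_nonneg hc.le, inv_mul_le_iff₀ hc]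
    refine h1.trans (mul_le_mul_of_nonneg_left ?_ hc.le)
    nlinarith [norm_nonneg f]
  refine ⟨A.mkContinuous lam hA, LinearMap.mkContinuous_norm_le _ (by linarith) _, ?_, ?_⟩
  · intro x
    change (Fintype.card H : ℝ)⁻¹ • ∑ h : H, x = x
    rw [Finset.sum_const, Finset.card_univ, ← Nat.cast_smul_eq_nsmul ℝ, smul_smul,
      inv_mul_cancel₀ hc.ne', one_smul]
  · intro s f
    constructor
    · change (Fintype.card H : ℝ)⁻¹ • ∑ h : H, f (s + h) = (Fintype.card H : ℝ)⁻¹ • ∑ h : H, f h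
      rw [← Equiv.sum_comp (Equiv.addLeft s) (fun h => f h)]
      rfl
    · change (Fintype.card H : ℝ)⁻¹ • ∑ h : H, f (h + s) = (Fintype.card H : ℝ)⁻¹ • ∑ h : H, f h
      rw [← Equiv.sum_comp (Equiv.addRight s) (fun h => f h)]
      rfl

theorem infinite_case {G X : Type*} [AddGroup G] [NormedAddCommGroup X] [NormedSpace ℝ X]
    [Nontrivial X] [Infinite G] (H : AddSubgroup G) (lam : ℝ) (M : Linf G X →L[ℝ] X)
    (hM : IsInvMean lam M) : ∃ M' : Linf H X →L[ℝ] X, IsInvMean lam M' := by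
  classical
  have hlam : 0 ≤ lam := (norm_nonneg _).trans hM.1
  obtain ⟨θ, hθ⟩ : ∃ θ : G → Finset G, ∀ s, ∃ t : ℕ → G, ∀ i j, i < j → ∀ g,
      s ∈ θ (g + t i) ∨ s ∈ θ (g + t j) := by
    rcases Classical.em (Countable G) with hG | hG
    · exact theta_countable G
    · have := not_countable_iff.1 hG
      exact theta_uncountable G
  obtain ⟨m, hm1, hm⟩ := exists_scalar_mean H lam M hM
  have hR : ∀ S : Finset G, ∃ p : H →₀ ℝ, l1n p = 1 ∧
      Finsupp.linearCombination ℝ (fun _ : H => (1 : ℝ)) p = 1 ∧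
      ∀ s : H, (s : G) ∈ S → l1n (p.mapDomain (fun h => s + h) - p) ≤ 1 / ((S.card : ℝ) + 1) := by
    intro S
    obtain ⟨p, h1, h2, h3⟩ := exists_reiter m hm1 hm (S.subtype (· ∈ H)) (1 / ((S.card : ℝ) + 1))
      (by positivity)
    exact ⟨p, h1, h2, fun s hs => h3 s (by simpa using hs)⟩
  choose p hp1 hp2 hp3 using hR
  let P : Linf H X → Linf G X := fun f =>
    mkL (fun g => dAvg (p (θ g)) f) ‖f‖ (fun g => dAvg_norm_le _ (hp1 _) f)
  have hP : ∀ f g, P f g = dAvg (p (θ g)) f := fun _ _ => rfl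
  have Padd : ∀ f f', P (f + f') = P f + P f' := by
    intro f f'
    ext g
    rw [lp.coeFn_add, Pi.add_apply, hP, hP, hP]
    unfold dAvg
    rw [← lc_add_fun]
    simp only [← lc_add_fun]
    rfl
  have Psmul : ∀ (c : ℝ) f, P (c • f) = c • P f := by
    intro c f
    ext g
    rw [lp.coeFn_smul, Pi.smul_apply, hP, hP]
    unfold dAvg
    rw [← lc_smul_fun]
    simp only [← lc_smul_fun]
    rfl
  let A : Linf H X →ₗ[ℝ] X :=
    { toFun := fun f => M (P f)
      map_add' := fun f f' => by rw [Padd, map_add]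
      map_smul' := fun c f => by rw [Psmul, map_smul]; rfl }
  have hA : ∀ f, ‖A f‖ ≤ lam * ‖f‖ := by
    intro f
    refine (M.le_opNorm _).trans (mul_le_mul hM.1 ?_ (norm_nonneg _) hlam)
    exact lp.norm_le_of_forall_le (norm_nonneg _) fun g => dAvg_norm_le _ (hp1 _) f
  have main : ∀ (s : H) (f f' : Linf H X), (∀ g, (s : G) ∈ θ g → -(s : G) ∈ θ g →
      ‖dAvg (p (θ g)) f' - dAvg (p (θ g)) f‖ ≤ ‖f‖ * (1 / (((θ g).card : ℝ) + 1))) →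
      M (P f') = M (P f) := by
    intro s f f' hff
    rw [← sub_eq_zero, ← map_sub]
    refine zero_of_forall_mul_le _ (lam * ‖f‖) (by positivity) fun δ hδ => ?_
    obtain ⟨n, hn⟩ := exists_nat_gt (1 / δ)
    obtain ⟨S, hS⟩ := Infinite.exists_subset_card_eq G n
    rw [mul_assoc]
    refine mean_small lam M hM θ hθ (S ∪ {(s : G), -(s : G)}) _ (‖f‖ * δ) (by positivity) ?_
    intro g hg
    rw [lp.coeFn_sub, Pi.sub_apply, hP, hP]
    refine (hff g (hg (by simp)) (hg (by simp))).trans ?_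
    refine mul_le_mul_of_nonneg_left ?_ (norm_nonneg _)
    have hcard : n ≤ (θ g).card := by
      rw [← hS]
      exact Finset.card_le_card (Finset.subset_union_left.trans hg)
    have hcard' : (n : ℝ) ≤ (θ g).card := by exact_mod_cast hcard
    rw [div_le_iff₀ (by positivity)]
    rw [div_lt_iff₀ hδ] at hn
    nlinarith
  refine ⟨A.mkContinuous lam hA, LinearMap.mkContinuous_norm_le _ hlam _, ?_, ?_⟩
  · intro x
    change M (P (linfConst H x)) = x
    have : P (linfConst H x) = linfConst G x := by
      ext g
      rw [hP]
      change Finsupp.linearCombination ℝ (fun a => Finsupp.linearCombination ℝ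
        (fun b => x) (p (θ g))) (p (θ g)) = x
      rw [lc_const_fun _ _ (hp2 _), lc_const_fun _ _ (hp2 _)]
    rw [this, hM.2.1]
  · intro s f
    constructor
    · refine main s f (lTrans s f) fun g h1 h2 => ?_
      exact (dAvg_left _ (hp1 _) f s).trans
        (mul_le_mul_of_nonneg_left (hp3 _ s h1) (norm_nonneg _))
    · refine main s f (rTrans s f) fun g h1 h2 => ?_
      exact (dAvg_right _ (hp1 _) f s).trans
        (mul_le_mul_of_nonneg_left (hp3 _ (-s) (by simpa using h2)) (norm_nonneg _))

theorem invariant_mean_passes_to_subgroup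
    {G X : Type*} [AddGroup G] [NormedAddCommGroup X] [NormedSpace ℝ X] [CompleteSpace X]
    (H : AddSubgroup G) (lam : ℝ)
    (h : ∃ M : Linf G X →L[ℝ] X, IsInvMean lam M) :
    ∃ M' : Linf H X →L[ℝ] X, IsInvMean lam M' := by
  obtain ⟨M, hM⟩ := h
  have hlam : 0 ≤ lam := (norm_nonneg _).trans hM.1
  rcases subsingleton_or_nontrivial X with hX | hX
  · exact ⟨0, by simpa using hlam, fun x => Subsingleton.elim _ _,
      fun s f => ⟨Subsingleton.elim _ _, Subsingleton.elim _ _⟩⟩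
  rcases finite_or_infinite H with hH | hH
  · refine finite_case lam ?_
    obtain ⟨x, hx⟩ := exists_ne (0 : X)
    have h1 := M.le_opNorm (linfConst G x)
    rw [hM.2.1] at h1
    have h2 : ‖linfConst G x‖ ≤ ‖x‖ :=
      lp.norm_le_of_forall_le (norm_nonneg _) fun g => le_rfl
    have h3 : ‖x‖ ≤ lam * ‖x‖ := h1.trans (mul_le_mul hM.1 h2 (norm_nonneg _) hlam)
    have h4 : 0 < ‖x‖ := norm_pos_iff.2 hx
    nlinarith
  · have : Infinite G := Infinite.of_injective ((↑) : H → G) Subtype.val_injective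
    exact infinite_case H lam M hM

end
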